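/- Let Γ be an n-vertex connected nonregular finite simple graph whose adjacency matrix has exactly three distinct eigenvalues s > 1 > −t, which is not a cone and not biregular, and suppose t ≥ 7. Then the minimum vertex degree satisfies δ(Γ) ≥ t + 2. -/

import Mathlib

open Finset in
/-- The combinatorial relations satisfied by the (integral) Perron weights `α` of a connected graph
whose adjacency eigenvalues are `s > 1 > -T`. -/
structure SimpleGraph.IsTripleWeighting {V : Type} [Fintype V] [DecidableEq V]
    (Γ : SimpleGraph V) [DecidableRel Γ.Adj] (T s : ℤ) (α : V → ℤ) : Prop where
  pos : ∀ v, 1 ≤ α v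
  degree : ∀ v, (#(Γ.neighborFinset v) : ℤ) = T + α v ^ 2
  adj : ∀ u v, Γ.Adj u v →
    (#(Γ.neighborFinset u ∩ Γ.neighborFinset v) : ℤ) = α u * α v - (T - 1)
  not_adj : ∀ u v, u ≠ v → ¬ Γ.Adj u v →
    (#(Γ.neighborFinset u ∩ Γ.neighborFinset v) : ℤ) = α u * α v
  eigen : ∀ v, ∑ w ∈ Γ.neighborFinset v, α w = s * α v
  edge : ∀ x y v, Γ.Adj x y → ¬ Γ.Adj x v → ¬ Γ.Adj y v →
    #(Γ.neighborFinset v \ (Γ.neighborFinset x ∪ Γ.neighborFinset y)) ≤ 1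

namespace SimpleGraph.IsTripleWeighting

open Finset

variable {V : Type} [Fintype V] [DecidableEq V] {Γ : SimpleGraph V} [DecidableRel Γ.Adj]
  {T s : ℤ} {α : V → ℤ}

theorem weight_of_adj (h : Γ.IsTripleWeighting T s α) {x y : V} (hx : α x = 1)
    (hxy : Γ.Adj x y) :
    α y = T - 1 + #(Γ.neighborFinset x ∩ Γ.neighborFinset y) := by
  have := h.adj x y hxy
  rw [hx] at this
  linarith

theorem weight_of_not_adj (h : Γ.IsTripleWeighting T s α) {x v : V} (hx : α x = 1)
    (hne : x ≠ v) (hxv : ¬ Γ.Adj x v) :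
    α v = #(Γ.neighborFinset x ∩ Γ.neighborFinset v) := by
  have := h.not_adj x v hne hxv
  rw [hx] at this
  linarith

theorem card_neighborFinset (h : Γ.IsTripleWeighting T s α) {x : V} (hx : α x = 1) :
    (#(Γ.neighborFinset x) : ℤ) = T + 1 := by
  rw [h.degree, hx]; ring

/-- If `v` and `y` are nonadjacent, `y` is adjacent to the weight-one vertex `x` and `v` is not,
then there are only three possibilities for the weight of `v`. -/
theorem missing_cases (h : Γ.IsTripleWeighting T s α) (hT : 7 ≤ T) {x y v : V} (hx : α x = 1)
    (hxy : Γ.Adj x y) (hxv : ¬ Γ.Adj x v) (hyv : ¬ Γ.Adj y v) :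
    (α v = 1 ∧ (#(Γ.neighborFinset x ∩ Γ.neighborFinset y) : ℤ) ≤ 2) ∨
    (α v = T - 1 ∧ (#(Γ.neighborFinset x ∩ Γ.neighborFinset y) : ℤ) = 0) ∨
    (α v = T ∧ (#(Γ.neighborFinset x ∩ Γ.neighborFinset y) : ℤ) = 1) := by
  have hne : x ≠ v := by rintro rfl; exact hyv hxy.symm
  have hne' : y ≠ v := by rintro rfl; exact hxv hxy
  have hε := h.edge x y v hxy hxv hyv
  have hb := h.weight_of_adj hx hxy
  have hc := h.weight_of_not_adj hx hne hxv
  have hbc := h.not_adj y v hne' hyv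
  have hd := h.degree v
  have hpos := h.pos v
  have hcT : α v ≤ T := by
    have h1 : Γ.neighborFinset x ∩ Γ.neighborFinset v ⊂ Γ.neighborFinset x := by
      refine ⟨inter_subset_left, fun hsub => ?_⟩
      have := hsub ((Γ.mem_neighborFinset x y).2 hxy)
      simp only [mem_inter, mem_neighborFinset] at this
      exact hyv this.2.symm
    have := card_lt_card h1
    have := h.card_neighborFinset hx
    lia
  set A := Γ.neighborFinset x
  set B := Γ.neighborFinset y
  set C := Γ.neighborFinset v
  have e1 : #(C \ (A ∪ B)) + #(C ∩ (A ∪ B)) = #C := card_sdiff_add_card_inter C (A ∪ B)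
  have e2 : #(C ∩ (A ∪ B)) + #(A ∩ B ∩ C) = #(A ∩ C) + #(B ∩ C) := by
    have := card_union_add_card_inter (A ∩ C) (B ∩ C)
    rw [← this]
    congr 2
    · ext w; simp only [mem_inter, mem_union]; tauto
    · ext w; simp only [mem_inter]; tauto
  have e3 : #(A ∩ B ∩ C) ≤ #(A ∩ B) := card_le_card inter_subset_left
  have e4 : #(A ∩ B ∩ C) ≤ #(A ∩ C) :=
    card_le_card (by intro w; simp only [mem_inter]; tauto)
  generalize #(A ∩ B ∩ C) = g at *
  generalize #(A ∩ B) = a at *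
  generalize #(C \ (A ∪ B)) = ε at *
  have key : α v ^ 2 - (1 + α y) * α v + T - ε + g = 0 := by
    zify at e1 e2
    linarith
  rw [hb] at key
  zify at hε e3 e4
  have hg0 : (0 : ℤ) ≤ g := by positivity
  have hε0 : (0 : ℤ) ≤ ε := by positivity
  rw [← hc] at e4
  obtain ⟨k, hk⟩ : ∃ k, k = T + a - α v := ⟨_, rfl⟩
  have hkc : k * α v = T - ε + g := by rw [hk]; linarith
  have hkpos : 1 ≤ k := by
    by_contra hcon
    have := mul_nonneg (show 0 ≤ -k by lia) (show 0 ≤ α v by lia)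
    linarith
  have hag : (a : ℤ) - g = 1 - ε - (α v - 1) * (k - 1) := by linarith
  rcases eq_or_lt_of_le hpos with h1 | h1
  · left
    refine ⟨h1.symm, ?_⟩
    rw [← h1] at hag
    linarith
  rcases eq_or_lt_of_le hkpos with h2 | h2
  · right
    rw [← h2] at hag hk
    by_cases ha : (a : ℤ) = 0
    · left; exact ⟨by linarith, ha⟩
    · right; constructor <;> lia
  · exfalso
    have : (α v - 1) * (k - 1) ≤ 1 := by linarith
    have h4 := mul_nonneg (show 0 ≤ α v - 2 by lia) (show 0 ≤ k - 2 by lia)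
    have h5 : α v + k ≤ 4 := by linarith
    lia

/-- The neighbourhood of a weight-one vertex is not a coclique. -/
theorem false_of_coclique (h : Γ.IsTripleWeighting T s α) (hT : 7 ≤ T) {x : V} (hx : α x = 1)
    (h0 : ∀ y, Γ.Adj x y → (#(Γ.neighborFinset x ∩ Γ.neighborFinset y) : ℤ) = 0) : False := by
  have hN := h.card_neighborFinset hx
  have hs : s = (T + 1) * (T - 1) := by
    have h1 := h.eigen x
    rw [hx, sum_congr rfl (g := fun _ => T - 1)] at h1
    · rw [sum_const, nsmul_eq_mul, hN] at h1
      linarith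
    · intro y hy
      have hy' := (Γ.mem_neighborFinset x y).1 hy
      rw [h.weight_of_adj hx hy', h0 y hy']
      ring
  obtain ⟨y, hy⟩ : (Γ.neighborFinset x).Nonempty := by
    rw [← card_pos]; lia
  have hxy := (Γ.mem_neighborFinset x y).1 hy
  have hαy : α y = T - 1 := by rw [h.weight_of_adj hx hxy, h0 y hxy]; ring
  have hdy := h.degree y
  rw [hαy] at hdy
  have hmx : x ∈ Γ.neighborFinset y := (Γ.mem_neighborFinset y x).2 hxy.symm
  have hle : ∀ w ∈ (Γ.neighborFinset y).erase x, α w ≤ T - 1 := by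
    intro w hw
    obtain ⟨hwx, hw⟩ := mem_erase.1 hw
    have hyw := (Γ.mem_neighborFinset y w).1 hw
    have hxw : ¬ Γ.Adj x w := by
      intro hxw
      have h1 := h0 y hxy
      have h2 : w ∈ Γ.neighborFinset x ∩ Γ.neighborFinset y := by
        simp [hxw, hyw]
      have := card_pos.2 ⟨w, h2⟩
      lia
    by_cases hmiss : ∃ y', Γ.Adj x y' ∧ ¬ Γ.Adj y' w
    · obtain ⟨y', hy', hyw'⟩ := hmiss
      have h1 := h0 y' hy'
      rcases h.missing_cases hT hx hy' hxw hyw' with h2 | h2 | h2 <;> lia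
    · exfalso
      push Not at hmiss
      have h1 : α w = T + 1 := by
        rw [h.weight_of_not_adj hx hwx.symm hxw, inter_eq_left.2, hN]
        intro y' hy'
        rw [mem_neighborFinset] at hy' ⊢
        exact (hmiss y' hy').symm
      have h2 := h.adj y w hyw
      rw [h1, hαy] at h2
      have h3 : Γ.neighborFinset y ∩ Γ.neighborFinset w ⊆
          ((Γ.neighborFinset y).erase x).erase w := by
        intro p hp
        simp only [mem_inter, mem_neighborFinset] at hp
        simp only [mem_erase, mem_neighborFinset]
        refine ⟨?_, ?_, hp.1⟩
        · rintro rfl; exact Γ.irrefl hp.2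
        · rintro rfl; exact hxw hp.2.symm
      have h4 := card_le_card h3
      have h5 : #(((Γ.neighborFinset y).erase x).erase w) + 1 = #((Γ.neighborFinset y).erase x) :=
        card_erase_add_one (mem_erase.2 ⟨hwx, hw⟩)
      have h6 := card_erase_add_one hmx
      zify at h4 h5 h6
      nlinarith
  have h1 := h.eigen y
  rw [← add_sum_erase _ _ hmx, hx, hαy, hs] at h1
  have h2 := sum_le_card_nsmul _ _ _ hle
  have h6 := card_erase_add_one hmx
  zify at h6
  rw [nsmul_eq_mul] at h2
  have h7 : (#((Γ.neighborFinset y).erase x) : ℤ) = T + (T - 1) ^ 2 - 1 := by linarith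
  rw [h7] at h2
  nlinarith

/-- Degree count at a neighbour `y` of `x`, organised by adjacency to another neighbour `y₁` that
lies in a single triangle with `x`. -/
theorem degree_split (h : Γ.IsTripleWeighting T s α) (hT : 7 ≤ T) {x y₁ y : V} (hx : α x = 1)
    (hxy₁ : Γ.Adj x y₁) (hxy : Γ.Adj x y) (hne : y₁ ≠ y)
    (h1 : (#(Γ.neighborFinset x ∩ Γ.neighborFinset y₁) : ℤ) = 1) :
    #{v | v ≠ x ∧ ¬ Γ.Adj x v ∧ α v ≠ 1 ∧ ¬ Γ.Adj y₁ v} +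
      #{v | v ≠ x ∧ ¬ Γ.Adj x v ∧ α v = 1 ∧ Γ.Adj y v} +
      #((Γ.neighborFinset x ∩ Γ.neighborFinset y) \ Γ.neighborFinset y₁) +
      #(Γ.neighborFinset y₁ ∩ Γ.neighborFinset y) = #(Γ.neighborFinset y) := by
  have hN := h.card_neighborFinset hx
  have hD : ∀ v, v ≠ x → ¬ Γ.Adj x v → α v ≠ 1 → ¬ Γ.Adj y₁ v → Γ.Adj y v := by
    intro v hvx hxv hv1 hv
    by_contra hyv
    have hvT : α v = T := by
      rcases h.missing_cases hT hx hxy₁ hxv hv with h2 | h2 | h2 <;> lia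
    have h3 : Γ.neighborFinset x ∩ Γ.neighborFinset v ⊆
        ((Γ.neighborFinset x).erase y₁).erase y := by
      intro p hp
      simp only [mem_inter, mem_neighborFinset] at hp
      simp only [mem_erase, mem_neighborFinset]
      refine ⟨?_, ?_, hp.1⟩
      · rintro rfl; exact hyv hp.2.symm
      · rintro rfl; exact hv hp.2.symm
    have h4 := card_le_card h3
    have h5 : #(((Γ.neighborFinset x).erase y₁).erase y) + 1 = #((Γ.neighborFinset x).erase y₁) :=
      card_erase_add_one (mem_erase.2 ⟨hne.symm, (Γ.mem_neighborFinset x y).2 hxy⟩)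
    have h6 := card_erase_add_one ((Γ.mem_neighborFinset x y₁).2 hxy₁)
    have := h.weight_of_not_adj hx hvx.symm hxv
    lia
  have hS : ∀ v, v ≠ x → ¬ Γ.Adj x v → α v = 1 → Γ.Adj y v → ¬ Γ.Adj y₁ v := by
    intro v hvx hxv hv1 hyv hy₁v
    have h2 := h.weight_of_not_adj hx hvx.symm hxv
    have h3 : ({y₁, y} : Finset V) ⊆ Γ.neighborFinset x ∩ Γ.neighborFinset v := by
      intro p hp
      simp only [mem_insert, mem_singleton] at hp
      simp only [mem_inter, mem_neighborFinset]
      rcases hp with rfl | rfl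
      · exact ⟨hxy₁, hy₁v.symm⟩
      · exact ⟨hxy, hyv.symm⟩
    have h4 := card_le_card h3
    rw [card_pair hne] at h4
    lia
  rw [← card_union_of_disjoint, ← card_union_of_disjoint, ← card_union_of_disjoint]
  · congr 1
    ext v
    simp only [mem_union, mem_filter, mem_univ, true_and, mem_inter, mem_sdiff, mem_neighborFinset]
    constructor
    · rintro (((⟨a, b, c, d⟩ | h) | h) | h)
      · exact hD v a b c d
      all_goals tauto
    · intro hyv
      by_cases hvx : v = x
      · subst hvx; right; exact ⟨hxy₁.symm, hyv⟩
      tauto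
  · rw [Finset.disjoint_left]
    intro v
    simp only [mem_union, mem_filter, mem_univ, true_and, mem_inter, mem_sdiff, mem_neighborFinset]
    rintro ((hv | hv) | hv) ⟨h7, h8⟩
    · exact hv.2.2.2 h7
    · exact hS v hv.1 hv.2.1 hv.2.2.1 hv.2.2.2 h7
    · exact hv.2 h7
  · rw [Finset.disjoint_left]
    intro v
    simp only [mem_union, mem_filter, mem_univ, true_and, mem_inter, mem_sdiff, mem_neighborFinset]
    tauto
  · rw [Finset.disjoint_left]
    intro v
    simp only [mem_filter, mem_univ, true_and]
    tauto

theorem neighbor_unique {x y p q : V}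
    (h1 : (#(Γ.neighborFinset x ∩ Γ.neighborFinset y) : ℤ) = 1)
    (hxp : Γ.Adj x p) (hyp : Γ.Adj y p) (hxq : Γ.Adj x q) (hyq : Γ.Adj y q) : p = q := by
  have := card_le_one.1 (by exact_mod_cast h1.le)
  exact this p (by simp [*]) q (by simp [*])

theorem exists_neighbor {x y : V}
    (h1 : (#(Γ.neighborFinset x ∩ Γ.neighborFinset y) : ℤ) ≠ 0) :
    ∃ p, Γ.Adj x p ∧ Γ.Adj y p := by
  obtain ⟨p, hp⟩ : (Γ.neighborFinset x ∩ Γ.neighborFinset y).Nonempty := by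
    rw [← card_pos]; lia
  exact ⟨p, by simpa using hp⟩

/-- Comparison of the numbers of further weight-one vertices at an edge `y₁y₂` and at a vertex `y₃`
off that edge, in the local graph of `x`. -/
theorem card_weight_one (h : Γ.IsTripleWeighting T s α) (hT : 7 ≤ T) {x y₁ y₂ y₃ : V}
    (hx : α x = 1) (hxy₁ : Γ.Adj x y₁) (hxy₂ : Γ.Adj x y₂) (hxy₃ : Γ.Adj x y₃)
    (h1 : (#(Γ.neighborFinset x ∩ Γ.neighborFinset y₁) : ℤ) = 1)
    (h2 : (#(Γ.neighborFinset x ∩ Γ.neighborFinset y₂) : ℤ) = 1)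
    (h3 : (#(Γ.neighborFinset x ∩ Γ.neighborFinset y₃) : ℤ) ≤ 1)
    (h12 : Γ.Adj y₁ y₂) (h13 : y₁ ≠ y₃) (h23 : y₂ ≠ y₃) :
    (#{v | v ≠ x ∧ ¬ Γ.Adj x v ∧ α v = 1 ∧ Γ.Adj y₂ v} : ℤ) =
      #{v | v ≠ x ∧ ¬ Γ.Adj x v ∧ α v = 1 ∧ Γ.Adj y₃ v} +
        if (#(Γ.neighborFinset x ∩ Γ.neighborFinset y₃) : ℤ) = 1 then T - 1 else 2 * T - 3 := by
  have hn13 : ¬ Γ.Adj y₁ y₃ := fun hadj => h23 (neighbor_unique h1 hxy₂ h12 hxy₃ hadj)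
  have s2 := h.degree_split hT hx hxy₁ hxy₂ h12.ne h1
  have s3 := h.degree_split hT hx hxy₁ hxy₃ h13 h1
  have e2 : (Γ.neighborFinset x ∩ Γ.neighborFinset y₂) \ Γ.neighborFinset y₁ =
      Γ.neighborFinset x ∩ Γ.neighborFinset y₂ := by
    rw [Finset.sdiff_eq_self_iff_disjoint, Finset.disjoint_left]
    intro p hp hp1
    simp only [mem_inter, mem_neighborFinset] at hp hp1
    have := neighbor_unique h1 hp.1 hp1 hxy₂ h12
    subst this
    exact Γ.irrefl hp.2
  have e3 : (Γ.neighborFinset x ∩ Γ.neighborFinset y₃) \ Γ.neighborFinset y₁ =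
      Γ.neighborFinset x ∩ Γ.neighborFinset y₃ := by
    rw [Finset.sdiff_eq_self_iff_disjoint, Finset.disjoint_left]
    intro p hp hp1
    simp only [mem_inter, mem_neighborFinset] at hp hp1
    have := neighbor_unique h1 hp.1 hp1 hxy₂ h12
    subst this
    exact h13 (neighbor_unique h2 hxy₁ h12.symm hxy₃ hp.2.symm)
  rw [e2] at s2
  rw [e3] at s3
  have w1 := h.weight_of_adj hx hxy₁
  have w2 := h.weight_of_adj hx hxy₂
  have w3 := h.weight_of_adj hx hxy₃
  have c2 := h.adj y₁ y₂ h12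
  have c3 := h.not_adj y₁ y₃ h13 hn13
  have d2 := h.degree y₂
  have d3 := h.degree y₃
  rw [h1] at w1
  rw [h2] at w2
  zify at s2 s3
  rw [w1, w2] at c2
  rw [w1] at c3
  rw [w2] at d2
  rcases (show (#(Γ.neighborFinset x ∩ Γ.neighborFinset y₃) : ℤ) = 1 ∨
      (#(Γ.neighborFinset x ∩ Γ.neighborFinset y₃) : ℤ) = 0 by lia) with h4 | h4
  · rw [if_pos h4]
    rw [h4] at w3 s3
    rw [w3] at d3 c3
    rw [h2] at s2
    linarith
  · rw [if_neg (by lia)]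
    rw [h4] at w3 s3
    rw [w3] at d3 c3
    rw [h2] at s2
    linarith

theorem false_of_two_edges (h : Γ.IsTripleWeighting T s α) (hT : 7 ≤ T) {x y₁ y₂ y₃ y₄ : V}
    (hx : α x = 1) (hxy₁ : Γ.Adj x y₁) (hxy₂ : Γ.Adj x y₂) (hxy₃ : Γ.Adj x y₃) (hxy₄ : Γ.Adj x y₄)
    (h1 : (#(Γ.neighborFinset x ∩ Γ.neighborFinset y₁) : ℤ) = 1)
    (h2 : (#(Γ.neighborFinset x ∩ Γ.neighborFinset y₂) : ℤ) = 1)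
    (h3 : (#(Γ.neighborFinset x ∩ Γ.neighborFinset y₃) : ℤ) = 1)
    (h4 : (#(Γ.neighborFinset x ∩ Γ.neighborFinset y₄) : ℤ) = 1)
    (h12 : Γ.Adj y₁ y₂) (h34 : Γ.Adj y₃ y₄) (h13 : y₁ ≠ y₃) (h23 : y₂ ≠ y₃) : False := by
  have h24 : y₂ ≠ y₄ := by
    rintro rfl
    exact h13 (neighbor_unique h2 hxy₁ h12.symm hxy₃ h34.symm)
  have e1 := h.card_weight_one hT hx hxy₁ hxy₂ hxy₃ h1 h2 h3.le h12 h13 h23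
  have e2 := h.card_weight_one hT hx hxy₄ hxy₃ hxy₂ h4 h3 h2.le h34.symm h24.symm h23.symm
  rw [if_pos h3] at e1
  rw [if_pos h2] at e2
  linarith

/-- No two nonadjacent vertices of weight one. -/
theorem false_of_weight_one_pair (h : Γ.IsTripleWeighting T s α) (hT : 7 ≤ T)
    (hcone : ∀ v, ∃ w, v ≠ w ∧ ¬ Γ.Adj v w) {x z : V}
    (hx : α x = 1) (hz : α z = 1) (hne : x ≠ z) (hxz : ¬ Γ.Adj x z) : False := by
  have hN := h.card_neighborFinset hx
  have hNz := h.card_neighborFinset hz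
  have hc : (#(Γ.neighborFinset x ∩ Γ.neighborFinset z) : ℤ) = 1 := by
    rw [← h.weight_of_not_adj hx hne hxz, hz]
  obtain ⟨y₀, hxy₀, hzy₀⟩ := exists_neighbor (Γ := Γ) (x := x) (y := z) (by lia)
  have w0 := h.weight_of_adj hx hxy₀
  have w0' := h.weight_of_adj hz hzy₀
  have hzu : ∀ u, Γ.Adj x u → u ≠ y₀ → ¬ Γ.Adj z u := fun u hu hne' hzu =>
    hne' (neighbor_unique hc hu hzu hxy₀ hzy₀)
  have hxw : ∀ w, Γ.Adj z w → w ≠ y₀ → ¬ Γ.Adj x w := fun w hw hne' hxw =>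
    hne' (neighbor_unique hc hxw hw hxy₀ hzy₀)
  have big : ∀ u, Γ.Adj x u → T - 1 ≤ α u := fun u hu => by
    have := h.weight_of_adj hx hu
    lia
  have bigz : ∀ u, Γ.Adj z u → T - 1 ≤ α u := fun u hu => by
    have := h.weight_of_adj hz hu
    lia
  have hfull : ∀ v, Γ.Adj x v → v ≠ y₀ → ¬ Γ.Adj y₀ v →
      α v = T - 1 ∧ (#(Γ.neighborFinset x ∩ Γ.neighborFinset y₀) : ℤ) = 0 ∨
      α v = T ∧ (#(Γ.neighborFinset x ∩ Γ.neighborFinset y₀) : ℤ) = 1 := by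
    intro v hv hvy hyv
    have := big v hv
    rcases h.missing_cases hT hz hzy₀ (hzu v hv hvy) hyv with h1 | h1 | h1 <;> lia
  by_cases hall : ∀ v, Γ.Adj x v → v ≠ y₀ → Γ.Adj y₀ v
  · obtain ⟨v, hvy, hyv⟩ := hcone y₀
    have hxv : ¬ Γ.Adj x v := fun hv => hyv (hall v hv hvy.symm)
    have ha : (Γ.neighborFinset x).erase y₀ ⊆ Γ.neighborFinset x ∩ Γ.neighborFinset y₀ := by
      intro u hu
      simp only [mem_erase, mem_neighborFinset] at hu
      simp only [mem_inter, mem_neighborFinset]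
      exact ⟨hu.2, hall u hu.2 hu.1⟩
    have h1 := card_le_card ha
    have h2 := card_erase_add_one ((Γ.mem_neighborFinset x y₀).2 hxy₀)
    rcases h.missing_cases hT hx hxy₀ hxv hyv with h3 | h3 | h3 <;> lia
  push Not at hall
  obtain ⟨v, hxv, hvy, hyv⟩ := hall
  rcases hfull v hxv hvy hyv with ⟨-, ha⟩ | ⟨-, ha⟩
  · refine h.false_of_coclique hT hx fun u hu => ?_
    by_cases huy : u = y₀
    · rw [huy, ha]
    have hyu : ¬ Γ.Adj y₀ u := by
      intro hyu
      have : u ∈ Γ.neighborFinset x ∩ Γ.neighborFinset y₀ := by simp [hu, hyu]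
      have := card_pos.2 ⟨u, this⟩
      lia
    have := h.weight_of_adj hx hu
    rcases hfull u hu huy hyu with h1 | h1 <;> lia
  · obtain ⟨u₀, hxu₀, hyu₀⟩ := exists_neighbor (Γ := Γ) (x := x) (y := y₀) (by lia)
    have hone : ∀ u, Γ.Adj x u → u ≠ y₀ → u ≠ u₀ →
        (#(Γ.neighborFinset x ∩ Γ.neighborFinset u) : ℤ) = 1 := by
      intro u hu huy huu
      have hyu : ¬ Γ.Adj y₀ u := fun hyu => huu (neighbor_unique ha hu hyu hxu₀ hyu₀)
      have := h.weight_of_adj hx hu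
      rcases hfull u hu huy hyu with h1 | h1 <;> lia
    have hu₀ : (#(Γ.neighborFinset x ∩ Γ.neighborFinset u₀) : ℤ) ≤ 2 := by
      have := big u₀ hxu₀
      rcases h.missing_cases hT hx hxu₀ hxz
        (fun hadj => hzu u₀ hxu₀ hyu₀.ne' hadj.symm) with h3 | h3 | h3 <;> lia
    have step : ∀ F : Finset V, #F ≤ 2 → ∃ u, Γ.Adj x u ∧ u ≠ y₀ ∧ u ≠ u₀ ∧
        ¬ Γ.Adj u₀ u ∧ u ∉ F := by
      intro F hF
      by_contra hcon
      push Not at hcon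
      have hsub : Γ.neighborFinset x ⊆
          {y₀, u₀} ∪ (Γ.neighborFinset x ∩ Γ.neighborFinset u₀) ∪ F := by
        intro u hu
        have hu' := (Γ.mem_neighborFinset x u).1 hu
        simp only [mem_union, mem_insert, mem_singleton, mem_inter, mem_neighborFinset]
        have := hcon u hu'
        tauto
      have h1 := card_le_card hsub
      have h2 := card_union_le ({y₀, u₀} ∪ (Γ.neighborFinset x ∩ Γ.neighborFinset u₀)) F
      have h3 := card_union_le {y₀, u₀} (Γ.neighborFinset x ∩ Γ.neighborFinset u₀)
      have h4 : #({y₀, u₀} : Finset V) ≤ 2 := card_le_two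
      lia
    have mate : ∀ u, Γ.Adj x u → u ≠ y₀ → u ≠ u₀ → ¬ Γ.Adj u₀ u →
        ∃ w, Γ.Adj x w ∧ Γ.Adj u w ∧ (#(Γ.neighborFinset x ∩ Γ.neighborFinset w) : ℤ) = 1 := by
      intro u hu huy huu hn
      obtain ⟨w, hxw', huw⟩ := exists_neighbor (Γ := Γ) (x := x) (y := u)
        (by rw [hone u hu huy huu]; lia)
      refine ⟨w, hxw', huw, hone w hxw' ?_ ?_⟩
      · rintro rfl
        exact huu (neighbor_unique ha hu huw.symm hxu₀ hyu₀)
      · rintro rfl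
        exact hn huw.symm
    obtain ⟨u₁, a1, a2, a3, a4, -⟩ := step ∅ (by simp)
    obtain ⟨u₂, b1, b2, b3⟩ := mate u₁ a1 a2 a3 a4
    obtain ⟨u₃, c1, c2, c3, c4, c5⟩ := step {u₁, u₂} card_le_two
    obtain ⟨u₄, d1, d2, d3⟩ := mate u₃ c1 c2 c3 c4
    simp only [mem_insert, mem_singleton, not_or] at c5
    exact h.false_of_two_edges hT hx a1 b1 c1 d1 (hone u₁ a1 a2 a3) b3 (hone u₃ c1 c2 c3) d3
      b2 d2 (Ne.symm c5.1) (Ne.symm c5.2)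

/-- If no nonneighbour of `x` other than `x` has weight one, a vertex of the local graph at `x`
that lies in several triangles dominates everything outside that local graph. -/
theorem sdiff_subset_of_two_le (h : Γ.IsTripleWeighting T s α) (hT : 7 ≤ T) {x y y' : V}
    (hx : α x = 1) (huniq : ∀ v, x ≠ v → ¬ Γ.Adj x v → α v ≠ 1) (hxy' : Γ.Adj x y')
    (h2 : 2 ≤ (#(Γ.neighborFinset x ∩ Γ.neighborFinset y') : ℤ)) :
    Γ.neighborFinset y \ Γ.neighborFinset y' ⊆ Γ.neighborFinset x ∩ Γ.neighborFinset y := by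
  intro v hv
  simp only [mem_sdiff, mem_inter, mem_neighborFinset] at hv ⊢
  refine ⟨?_, hv.1⟩
  by_contra hxv
  have hxne : x ≠ v := by rintro rfl; exact hv.2 hxy'.symm
  have := huniq v hxne hxv
  rcases h.missing_cases hT hx hxy' hxv hv.2 with h3 | h3 | h3 <;> lia

theorem weight_ne_one (h : Γ.IsTripleWeighting T s α) (hT : 7 ≤ T)
    (hcone : ∀ v, ∃ w, v ≠ w ∧ ¬ Γ.Adj v w) (x : V) : α x ≠ 1 := by
  intro hx
  have hN := h.card_neighborFinset hx
  have huniq : ∀ v, x ≠ v → ¬ Γ.Adj x v → α v ≠ 1 := fun v hne hxv hv =>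
    h.false_of_weight_one_pair hT hcone hx hv hne hxv
  have hsplit : ∀ y y' : V, #(Γ.neighborFinset y \ Γ.neighborFinset y') +
      #(Γ.neighborFinset y ∩ Γ.neighborFinset y') = #(Γ.neighborFinset y) :=
    fun y y' => card_sdiff_add_card_inter _ _
  have htwo : ∀ y y', Γ.Adj x y → Γ.Adj x y' → y ≠ y' → α y' ≤ α y →
      2 ≤ (#(Γ.neighborFinset x ∩ Γ.neighborFinset y') : ℤ) → False := by
    intro y y' hy hy' hne hle h2
    have h3 := card_le_card (h.sdiff_subset_of_two_le hT (y := y) hx huniq hy' h2)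
    have h4 := hsplit y y'
    have h5 := h.degree y
    have hpos := h.pos y
    have h6 : #(Γ.neighborFinset x ∩ Γ.neighborFinset y) ≤ #((Γ.neighborFinset x).erase y) := by
      apply card_le_card
      intro v
      simp only [mem_inter, mem_neighborFinset, mem_erase]
      rintro ⟨p, q⟩
      exact ⟨q.ne', p⟩
    have h7 := card_erase_add_one ((Γ.mem_neighborFinset x y).2 hy)
    zify at h3 h4 h6 h7
    by_cases hadj : Γ.Adj y y'
    · have := h.adj y y' hadj
      nlinarith
    · have := h.not_adj y y' hne hadj
      have h8 : #(Γ.neighborFinset x ∩ Γ.neighborFinset y) ≤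
          #(((Γ.neighborFinset x).erase y).erase y') := by
        apply card_le_card
        intro v
        simp only [mem_inter, mem_neighborFinset, mem_erase]
        rintro ⟨p, q⟩
        refine ⟨?_, q.ne', p⟩
        rintro rfl
        exact hadj q
      have h9 : #(((Γ.neighborFinset x).erase y).erase y') + 1 = #((Γ.neighborFinset x).erase y) :=
        card_erase_add_one (mem_erase.2 ⟨hne.symm, (Γ.mem_neighborFinset x y').2 hy'⟩)
      zify at h8 h9
      nlinarith
  have hle1 : ∀ y, Γ.Adj x y → (#(Γ.neighborFinset x ∩ Γ.neighborFinset y) : ℤ) ≤ 1 := by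
    intro y hy
    by_contra hcon
    have h2 : 2 ≤ (#(Γ.neighborFinset x ∩ Γ.neighborFinset y) : ℤ) := by lia
    obtain ⟨y₁, hxy₁, hyy₁⟩ := exists_neighbor (Γ := Γ) (x := x) (y := y) (by lia)
    have w := h.weight_of_adj hx hy
    have w₁ := h.weight_of_adj hx hxy₁
    have hmem : y ∈ Γ.neighborFinset x ∩ Γ.neighborFinset y₁ := by simp [hy, hyy₁.symm]
    have hpos := card_pos.2 ⟨y, hmem⟩
    have h1 : (#(Γ.neighborFinset x ∩ Γ.neighborFinset y₁) : ℤ) = 1 := by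
      by_contra hne
      have h2' : 2 ≤ (#(Γ.neighborFinset x ∩ Γ.neighborFinset y₁) : ℤ) := by lia
      rcases le_total (α y) (α y₁) with hle | hle
      · exact htwo y₁ y hxy₁ hy hyy₁.ne' hle h2
      · exact htwo y y₁ hy hxy₁ hyy₁.ne hle h2'
    have h3 := card_le_card (h.sdiff_subset_of_two_le hT (y := y₁) hx huniq hy h2)
    have h4 : 0 < #(Γ.neighborFinset y₁ \ Γ.neighborFinset y) :=
      card_pos.2 ⟨y, by simp [hyy₁.symm]⟩
    have h5 := hsplit y₁ y
    have h6 := h.degree y₁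
    have h7 := h.adj y₁ y hyy₁.symm
    rw [h1] at w₁
    rw [w₁] at h6 h7
    zify at h3 h4 h5
    have h8 : T * (α y - T - 2) = -2 := by
      have : (#(Γ.neighborFinset y₁ \ Γ.neighborFinset y) : ℤ) = 1 := by lia
      rw [this] at h5
      linarith
    have h9 : T ∣ 2 := ⟨-(α y - T - 2), by linarith⟩
    have := Int.le_of_dvd (by norm_num) h9
    lia
  by_cases hall : ∀ y, Γ.Adj x y → (#(Γ.neighborFinset x ∩ Γ.neighborFinset y) : ℤ) = 0
  · exact h.false_of_coclique hT hx hall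
  push Not at hall
  obtain ⟨y₁, hxy₁, hy₁⟩ := hall
  have h1 : (#(Γ.neighborFinset x ∩ Γ.neighborFinset y₁) : ℤ) = 1 := by
    have := hle1 y₁ hxy₁
    lia
  obtain ⟨y₂, hxy₂, h12⟩ := exists_neighbor (Γ := Γ) (x := x) (y := y₁) hy₁
  have h2 : (#(Γ.neighborFinset x ∩ Γ.neighborFinset y₂) : ℤ) = 1 := by
    have := hle1 y₂ hxy₂
    have hmem : y₁ ∈ Γ.neighborFinset x ∩ Γ.neighborFinset y₂ := by simp [hxy₁, h12.symm]
    have hpos := card_pos.2 ⟨y₁, hmem⟩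
    lia
  obtain ⟨y₃, hy₃, hy₃'⟩ : ∃ y₃ ∈ Γ.neighborFinset x, y₃ ∉ ({y₁, y₂} : Finset V) := by
    apply exists_mem_notMem_of_card_lt_card
    have : #({y₁, y₂} : Finset V) ≤ 2 := card_le_two
    lia
  rw [mem_neighborFinset] at hy₃
  simp only [mem_insert, mem_singleton, not_or] at hy₃'
  have e := h.card_weight_one hT hx hxy₁ hxy₂ hy₃ h1 h2 (hle1 y₃ hy₃) h12
    (Ne.symm hy₃'.1) (Ne.symm hy₃'.2)
  have hzero : ∀ y, #{v | v ≠ x ∧ ¬ Γ.Adj x v ∧ α v = 1 ∧ Γ.Adj y v} = 0 := by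
    intro y
    rw [card_eq_zero, filter_eq_empty_iff]
    rintro v - ⟨p, q, r, -⟩
    exact huniq v p.symm q r
  rw [hzero, hzero] at e
  split_ifs at e <;> simp at e <;> lia

end SimpleGraph.IsTripleWeighting

namespace Matrix

variable {n : Type*} [Fintype n] [DecidableEq n] {A : Matrix n n ℝ}

/-- A real symmetric matrix is annihilated by the product over three values containing its
spectrum. -/
theorem IsHermitian.mul_mul_eq_zero_of_spectrum (hA : A.IsHermitian) {a b c : ℝ}
    (h : spectrum ℝ A ⊆ {a, b, c}) :
    (A - a • 1) * ((A - b • 1) * (A - c • 1)) = 0 := by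
  have key : ∀ r : ℝ, A - r • 1 = Unitary.conjStarAlgAut ℝ _ hA.eigenvectorUnitary
      (diagonal hA.eigenvalues - r • 1) := by
    intro r
    conv_lhs => rw [hA.spectral_theorem]
    rw [map_sub, map_smul, map_one]
    rfl
  have hd : ∀ r : ℝ, (diagonal hA.eigenvalues - r • 1 : Matrix n n ℝ) =
      diagonal (fun i => hA.eigenvalues i - r) := by
    intro r
    rw [smul_one_eq_diagonal, diagonal_sub]
  have hz : (diagonal hA.eigenvalues - a • 1) * ((diagonal hA.eigenvalues - b • 1) *
      (diagonal hA.eigenvalues - c • 1)) = 0 := by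
    rw [hd, hd, hd, diagonal_mul_diagonal, diagonal_mul_diagonal, ← diagonal_zero]
    congr 1
    funext i
    have := h (hA.eigenvalues_mem_spectrum_real i)
    simp only [Set.mem_insert_iff, Set.mem_singleton_iff] at this
    rcases this with h | h | h <;> simp [h]
  rw [key, key, key, ← map_mul, ← map_mul, hz, map_zero]

open scoped Pointwise in
theorem IsHermitian.posSemidef_smul_one_sub (hA : A.IsHermitian) {s : ℝ}
    (h : ∀ r ∈ spectrum ℝ A, r ≤ s) : (s • 1 - A).PosSemidef := by
  have hs : (s • 1 - A).IsHermitian := by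
    apply IsHermitian.sub _ hA
    simp [IsHermitian]
  rw [hs.posSemidef_iff_eigenvalues_nonneg]
  intro i
  have h1 : hs.eigenvalues i ∈ ({s} : Set ℝ) - spectrum ℝ A := by
    have h2 := hs.eigenvalues_mem_spectrum_real i
    rw [spectrum.singleton_sub_eq, Algebra.algebraMap_eq_smul_one]
    exact h2
  obtain ⟨_, rfl, r, hr, he⟩ := Set.mem_sub.1 h1
  have := h r hr
  rw [Pi.zero_apply, ← he]
  exact sub_nonneg.2 this

theorem exists_mulVec_eq_of_mem_spectrum {s : ℝ} (h : s ∈ spectrum ℝ A) :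
    ∃ v ≠ 0, A *ᵥ v = s • v := by
  rw [spectrum.mem_iff, isUnit_iff_isUnit_det, isUnit_iff_ne_zero, not_not,
    ← exists_mulVec_eq_zero_iff] at h
  obtain ⟨v, hv, h⟩ := h
  refine ⟨v, hv, ?_⟩
  rw [sub_mulVec, Algebra.algebraMap_eq_smul_one, smul_mulVec, one_mulVec, sub_eq_zero] at h
  exact h.symm

/-- If `f` is killed by `(A - 1)(A + t)` with `A` symmetric and `t > -1`, then the quadratic form
of `A - 1` is nonpositive at `f`. -/
theorem dotProduct_sub_one_mulVec_nonpos (hA : A.IsSymm) {t : ℝ} (ht : -1 < t) {f : n → ℝ}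
    (hf : ((A + t • 1) * (A - 1)) *ᵥ f = 0) : f ⬝ᵥ ((A - 1) *ᵥ f) ≤ 0 := by
  set g := (A - 1) *ᵥ f with hg
  have h1 : (A - 1) *ᵥ g = -(t + 1) • g := by
    rw [← mulVec_mulVec, ← hg, add_mulVec, smul_mulVec, one_mulVec] at hf
    rw [sub_mulVec, one_mulVec, eq_neg_of_add_eq_zero_left hf]
    module
  have h2 : g ⬝ᵥ g = -(t + 1) * (f ⬝ᵥ g) := by
    rw [← smul_eq_mul, ← dotProduct_smul, ← h1]
    conv_lhs => rw [hg, dotProduct_comm, dotProduct_mulVec, dotProduct_comm]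
    rw [← mulVec_transpose]
    have : (A - 1)ᵀ = A - 1 := by rw [transpose_sub, hA.eq, transpose_one]
    rw [this]
  have h3 : 0 ≤ g ⬝ᵥ g := by
    have := dotProduct_star_self_nonneg g
    simpa using this
  nlinarith

end Matrix

namespace SimpleGraph

open Finset Matrix

variable {V : Type} [Fintype V] {Γ : SimpleGraph V} [DecidableRel Γ.Adj] {s t : ℝ}

theorem Connected.pos_of_eigenvector (hconn : Γ.Connected) {w : V → ℝ} (hw : ∀ v, 0 ≤ w v)
    (hw0 : w ≠ 0) (h : Γ.adjMatrix ℝ *ᵥ w = s • w) (v : V) : 0 < w v := by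
  by_contra hv
  have hv0 : w v = 0 := le_antisymm (not_lt.1 hv) (hw v)
  apply hw0
  funext u
  have step : ∀ a b, Γ.Adj a b → w a = 0 → w b = 0 := by
    intro a b hab ha
    have h1 := congrFun h a
    rw [adjMatrix_mulVec_apply, Pi.smul_apply, ha, smul_zero] at h1
    exact (sum_eq_zero_iff_of_nonneg fun i _ => hw i).1 h1 b ((Γ.mem_neighborFinset a b).2 hab)
  obtain ⟨p⟩ := hconn.preconnected v u
  induction p with
  | nil => exact hv0
  | cons hab _ ih => exact ih (not_lt.2 (step _ _ hab hv0).le) (step _ _ hab hv0)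

variable [DecidableEq V]

theorem abs_eigenvector (hspec : ∀ r ∈ spectrum ℝ (Γ.adjMatrix ℝ), r ≤ s) {u : V → ℝ}
    (hu : Γ.adjMatrix ℝ *ᵥ u = s • u) : Γ.adjMatrix ℝ *ᵥ |u| = s • |u| := by
  have hH : (Γ.adjMatrix ℝ).IsHermitian := by
    rw [IsHermitian, conjTranspose_eq_transpose_of_trivial, transpose_adjMatrix]
  have hP := hH.posSemidef_smul_one_sub hspec
  have hsq : |u| ⬝ᵥ |u| = u ⬝ᵥ u := by
    simp [dotProduct, abs_mul_abs_self]
  have hle : u ⬝ᵥ (Γ.adjMatrix ℝ *ᵥ u) ≤ |u| ⬝ᵥ (Γ.adjMatrix ℝ *ᵥ |u|) := by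
    simp only [dotProduct, adjMatrix_mulVec_apply, mul_sum, Pi.abs_apply]
    refine sum_le_sum fun i _ => sum_le_sum fun j _ => ?_
    rw [← abs_mul]
    exact le_abs_self _
  have h0 : |u| ⬝ᵥ ((s • 1 - Γ.adjMatrix ℝ) *ᵥ |u|) = 0 := by
    apply le_antisymm
    · rw [hu, dotProduct_smul] at hle
      rw [sub_mulVec, smul_mulVec, one_mulVec, dotProduct_sub, dotProduct_smul, hsq]
      linarith
    · simpa using hP.dotProduct_mulVec_nonneg |u|
  have h1 := (hP.dotProduct_mulVec_zero_iff |u|).1 (by simpa using h0)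
  rw [sub_mulVec, smul_mulVec, one_mulVec, sub_eq_zero] at h1
  exact h1.symm

/-- The Perron eigenvector, normalised to express `(A - 1)(A + t)`. -/
theorem exists_perron (hconn : Γ.Connected) (hs : 1 < s) (ht : 0 < t)
    (hspec : spectrum ℝ (Γ.adjMatrix ℝ) = {s, 1, -t}) :
    ∃ α : V → ℝ, (∀ v, 0 < α v) ∧ Γ.adjMatrix ℝ *ᵥ α = s • α ∧
      (Γ.adjMatrix ℝ + t • 1) * (Γ.adjMatrix ℝ - 1) = vecMulVec α α := by
  set A := Γ.adjMatrix ℝ with hAdef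
  have hsymm : Aᵀ = A := Γ.transpose_adjMatrix
  have hH : A.IsHermitian := by
    rw [IsHermitian, conjTranspose_eq_transpose_of_trivial, hsymm]
  have hle : ∀ r ∈ spectrum ℝ A, r ≤ s := by
    rw [hspec]
    rintro r (rfl | rfl | rfl) <;> linarith
  obtain ⟨u, hu0, hu⟩ := exists_mulVec_eq_of_mem_spectrum (A := A) (s := s) (by simp [hspec])
  have hw := abs_eigenvector hle hu
  have hpos := hconn.pos_of_eigenvector (w := |u|) (fun v => abs_nonneg _) (by simpa using hu0) hw
  set w := |u|
  have huniq : ∀ z, A *ᵥ z = s • z → ∃ c : ℝ, z = c • w := by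
    intro z hz
    obtain ⟨x⟩ := hconn.nonempty
    refine ⟨z x / w x, ?_⟩
    by_contra hne
    have h1 : A *ᵥ (z - (z x / w x) • w) = s • (z - (z x / w x) • w) := by
      rw [mulVec_sub, mulVec_smul, hz, hw, smul_sub, smul_comm]
    have h2 := hconn.pos_of_eigenvector (w := |z - (z x / w x) • w|) (fun v => abs_nonneg _)
      (fun h0 => sub_ne_zero.2 hne (funext fun v => abs_eq_zero.1 (congrFun h0 v))) (abs_eigenvector hle h1) x
    simp [(hpos x).ne'] at h2
  set M := (A + t • 1) * (A - 1) with hM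
  have hM' : M = (A - 1) * (A + t • 1) := by
    rw [hM, add_mul, mul_add, Matrix.smul_mul, Matrix.mul_smul, one_mul, mul_one, sub_mul, mul_sub, mul_one,
      one_mul]
  have hMT : Mᵀ = M := by
    conv_lhs => rw [hM, transpose_mul, transpose_sub, transpose_add, transpose_smul,
      transpose_one, hsymm]
    exact hM'.symm
  have hAM : A * M = s • M := by
    have := hH.mul_mul_eq_zero_of_spectrum hspec.subset
    rw [one_smul, neg_smul, sub_neg_eq_add, ← hM', sub_mul, smul_mul, one_mul, sub_eq_zero] at this
    exact this
  have hcol : ∀ j, ∃ c : ℝ, M.col j = c • w := by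
    intro j
    apply huniq
    funext i
    exact congrFun (congrFun hAM i) j
  choose k hk using hcol
  have hMk : ∀ i j, M i j = k j * w i := fun i j => congrFun (hk j) i
  obtain ⟨x⟩ := hconn.nonempty
  have hkw : ∀ j, k j = k x / w x * w j := by
    intro j
    have h1 : M x j = M j x := congrFun (congrFun hMT.symm x) j
    rw [hMk, hMk] at h1
    have := (hpos x).ne'
    field_simp
    linarith
  set κ := k x / w x
  have hMw : M *ᵥ w = ((s - 1) * (s + t)) • w := by
    rw [hM', ← mulVec_mulVec, add_mulVec, smul_mulVec, one_mulVec, hw, ← add_smul, mulVec_smul,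
      sub_mulVec, one_mulVec, hw]
    module
  have hκ : 0 < κ := by
    have h1 := congrFun hMw x
    simp only [mulVec, dotProduct, hMk, hkw, Pi.smul_apply, smul_eq_mul] at h1
    have h2 : ∑ i, κ * w i * w x * w i = κ * (w x * ∑ i, w i * w i) := by
      rw [mul_sum, mul_sum]
      exact sum_congr rfl fun i _ => by ring
    rw [h2] at h1
    have h3 : 0 < (s - 1) * (s + t) * w x :=
      mul_pos (mul_pos (by linarith) (by linarith)) (hpos x)
    rw [← h1] at h3
    exact pos_of_mul_pos_left h3
      (mul_nonneg (hpos x).le (sum_nonneg fun i _ => mul_self_nonneg _))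
  refine ⟨√κ • w, fun v => mul_pos (Real.sqrt_pos.2 hκ) (hpos v), ?_, ?_⟩
  · rw [mulVec_smul, hw, smul_comm]
  · ext i j
    rw [hMk, hkw, vecMulVec_apply, Pi.smul_apply, Pi.smul_apply, smul_eq_mul, smul_eq_mul]
    have := Real.mul_self_sqrt hκ.le
    linear_combination (-w i * w j) * this

theorem card_inter_neighborFinset {α : V → ℝ}
    (hM : (Γ.adjMatrix ℝ + t • 1) * (Γ.adjMatrix ℝ - 1) = vecMulVec α α) (u v : V) :
    (#(Γ.neighborFinset u ∩ Γ.neighborFinset v) : ℝ) =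
      α u * α v - (t - 1) * Γ.adjMatrix ℝ u v + t * (1 : Matrix V V ℝ) u v := by
  have h1 : (Γ.adjMatrix ℝ + t • 1) * (Γ.adjMatrix ℝ - 1) =
      Γ.adjMatrix ℝ * Γ.adjMatrix ℝ + (t - 1) • Γ.adjMatrix ℝ - t • 1 := by
    rw [add_mul, mul_sub, mul_sub, mul_one, mul_one, smul_mul, one_mul]
    module
  have h2 : (Γ.adjMatrix ℝ * Γ.adjMatrix ℝ) u v =
      #(Γ.neighborFinset u ∩ Γ.neighborFinset v) := by
    rw [adjMatrix_mul_apply, card_eq_sum_ones, ← filter_mem_eq_inter]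
    simp [adjMatrix_apply, adj_comm]
  have h3 := congrFun (congrFun hM u) v
  rw [h1, vecMulVec_apply] at h3
  simp only [Matrix.sub_apply, Matrix.add_apply, Matrix.smul_apply, h2, smul_eq_mul] at h3
  linarith

/-- An edge has no induced path on three vertices among its common nonneighbours; this uses only
that the second largest eigenvalue is at most one. -/
theorem card_sdiff_neighborFinset_le_one (ht : 0 < t) {α : V → ℝ} (hα : ∀ v, 0 < α v)
    (hM : (Γ.adjMatrix ℝ + t • 1) * (Γ.adjMatrix ℝ - 1) = vecMulVec α α) {x y v : V}
    (hxy : Γ.Adj x y) (hxv : ¬ Γ.Adj x v) (hyv : ¬ Γ.Adj y v) :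
    #(Γ.neighborFinset v \ (Γ.neighborFinset x ∪ Γ.neighborFinset y)) ≤ 1 := by
  rw [card_le_one]
  intro p hp q hq
  by_contra hpq
  simp only [mem_sdiff, mem_union, mem_neighborFinset, not_or] at hp hq
  obtain ⟨hvp, hxp, hyp⟩ := hp
  obtain ⟨hvq, hxq, hyq⟩ := hq
  have nxy := hxy.ne
  have nvp := hvp.ne
  have nvq := hvq.ne
  have nxv : x ≠ v := by rintro rfl; exact hyv hxy.symm
  have nyv : y ≠ v := by rintro rfl; exact hxv hxy
  have nxp : x ≠ p := by rintro rfl; exact hyp hxy.symm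
  have nyp : y ≠ p := by rintro rfl; exact hxp hxy
  have nxq : x ≠ q := by rintro rfl; exact hyq hxy.symm
  have nyq : y ≠ q := by rintro rfl; exact hxq hxy
  set β := 3 * α v + 2 * α p + 2 * α q with hβ
  set γ := α x + α y with hγ
  set e : V → V → ℝ := fun i => Pi.single i 1 with he
  set f : V → ℝ := β • (e x + e y) - γ • ((3 : ℝ) • e v + (2 : ℝ) • e p + (2 : ℝ) • e q) with hf
  have hfα : α ⬝ᵥ f = 0 := by
    simp only [hf, he, dotProduct_sub, dotProduct_smul, dotProduct_add, dotProduct_single,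
      smul_eq_mul, hβ, hγ]
    ring
  have h0 : ((Γ.adjMatrix ℝ + t • 1) * (Γ.adjMatrix ℝ - 1)) *ᵥ f = 0 := by
    rw [hM, vecMulVec_mulVec, hfα]
    simp
  have h1 := dotProduct_sub_one_mulVec_nonpos (Γ.isSymm_adjMatrix (α := ℝ)) (by linarith) h0
  have hB : ∀ i j, e i ⬝ᵥ ((Γ.adjMatrix ℝ - 1) *ᵥ e j) = (Γ.adjMatrix ℝ - 1) i j := by
    intro i j
    simp [he]
  have hpq0 : 0 ≤ (Γ.adjMatrix ℝ - 1) p q := by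
    simp only [Matrix.sub_apply, one_apply_ne hpq, adjMatrix_apply]
    split_ifs <;> norm_num
  have hqp : (Γ.adjMatrix ℝ - 1) q p = (Γ.adjMatrix ℝ - 1) p q := by
    simp only [Matrix.sub_apply, one_apply_ne hpq, one_apply_ne (Ne.symm hpq), adjMatrix_apply, adj_comm]
  have hγpos : 0 < γ ^ 2 := pow_pos (add_pos (hα x) (hα y)) 2
  simp only [hf, mulVec_sub, mulVec_add, mulVec_smul, dotProduct_sub, dotProduct_add,
    dotProduct_smul, sub_dotProduct, add_dotProduct, smul_dotProduct, hB, hqp, smul_eq_mul] at h1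
  generalize (Γ.adjMatrix ℝ - 1) p q = B at *
  simp only [Matrix.sub_apply, adjMatrix_apply, one_apply, hxy, hxy.symm, hxv, hyv, hvp, hvp.symm, hvq,
    hvq.symm, hxp, hyp, hxq, hyq, Γ.adj_comm v x, Γ.adj_comm v y, Γ.adj_comm p x, Γ.adj_comm p y,
    Γ.adj_comm q x, Γ.adj_comm q y, Γ.irrefl, nxy, nxy.symm, nvp, nvp.symm, nvq, nvq.symm, nxv,
    nxv.symm, nyv, nyv.symm, nxp, nxp.symm, nyp, nyp.symm, nxq, nxq.symm, nyq, nyq.symm,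
    if_true, if_false] at h1
  have h2 : γ ^ 2 * (7 + 8 * B) ≤ 0 := by linarith
  have h3 : 0 < γ ^ 2 * (7 + 8 * B) := by positivity
  linarith

end SimpleGraph

namespace SimpleGraph

open Finset Matrix

variable {V : Type} [Fintype V] [DecidableEq V] {Γ : SimpleGraph V} [DecidableRel Γ.Adj] {s t : ℝ}

theorem isIntegral_of_mem_spectrum_adjMatrix {r : ℝ} (hr : r ∈ spectrum ℝ (Γ.adjMatrix ℝ)) :
    IsIntegral ℤ r := by
  have hmap : Γ.adjMatrix ℝ = (Γ.adjMatrix ℤ).map (Int.castRingHom ℝ) := by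
    ext i j
    simp [adjMatrix_apply, apply_ite]
  rw [mem_spectrum_iff_isRoot_charpoly, hmap, charpoly_map, Polynomial.IsRoot,
    Polynomial.eval_map] at hr
  exact ⟨_, charpoly_monic _, hr⟩

theorem exists_int_eq_of_isIntegral_of_mul_eq {r : ℝ} (hr : IsIntegral ℤ r) {a b : ℤ} (hb : b ≠ 0)
    (h : r * b = a) : ∃ m : ℤ, r = m := by
  have hb' : (b : ℝ) ≠ 0 := Int.cast_ne_zero.2 hb
  have hq : algebraMap ℚ ℝ (a / b) = r := by
    rw [eq_ratCast]
    push_cast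
    rw [← h, mul_div_cancel_right₀ _ hb']
  rw [← hq, isIntegral_algebraMap_iff (algebraMap ℚ ℝ).injective] at hr
  obtain ⟨m, hm⟩ := IsIntegrallyClosed.isIntegral_iff.1 hr
  refine ⟨m, ?_⟩
  rw [← hq, ← hm]
  simp

/-- The adjacency spectrum forces the Perron weights, once one of them is `1`, to be a
`SimpleGraph.IsTripleWeighting`. -/
theorem exists_isTripleWeighting (hconn : Γ.Connected) (hs : 1 < s) (ht : 0 < t)
    (hspec : spectrum ℝ (Γ.adjMatrix ℝ) = {s, 1, -t}) :
    ∃ T : ℤ, t = T ∧ ∀ x, (Γ.degree x : ℝ) < t + 2 →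
      ∃ (S : ℤ) (β : V → ℤ), β x = 1 ∧ Γ.IsTripleWeighting T S β := by
  obtain ⟨α, hpos, heig, hM⟩ := exists_perron hconn hs ht hspec
  have hcard := card_inter_neighborFinset hM
  have hdeg : ∀ v, (Γ.degree v : ℝ) = t + α v ^ 2 := by
    intro v
    have := hcard v v
    rw [inter_self, card_neighborFinset_eq_degree, adjMatrix_apply, if_neg Γ.irrefl,
      one_apply_eq] at this
    linarith
  have hadj : ∀ u v, Γ.Adj u v →
      (#(Γ.neighborFinset u ∩ Γ.neighborFinset v) : ℝ) = α u * α v - (t - 1) := by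
    intro u v huv
    rw [hcard, adjMatrix_apply, if_pos huv, one_apply_ne huv.ne]
    ring
  have hnot : ∀ u v, u ≠ v → ¬ Γ.Adj u v →
      (#(Γ.neighborFinset u ∩ Γ.neighborFinset v) : ℝ) = α u * α v := by
    intro u v huv h
    rw [hcard, adjMatrix_apply, if_neg h, one_apply_ne huv]
    ring
  obtain ⟨T, hT⟩ : ∃ T : ℤ, t = T := by
    obtain ⟨x⟩ := hconn.nonempty
    have hx : 0 < Γ.degree x := by
      have := hdeg x
      have h2 := sq_nonneg (α x)
      exact_mod_cast (by linarith : (0 : ℝ) < Γ.degree x)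
    obtain ⟨y, hxy⟩ := (Γ.degree_pos_iff_exists_adj x).1 hx
    have hintegral : IsIntegral ℤ t := by
      have := isIntegral_of_mem_spectrum_adjMatrix (Γ := Γ) (r := -t) (by simp [hspec])
      simpa using this.neg
    have h1 := hadj x y hxy
    set ν := #(Γ.neighborFinset x ∩ Γ.neighborFinset y)
    have hdx := hdeg x
    have hdy := hdeg y
    refine exists_int_eq_of_isIntegral_of_mul_eq hintegral
      (a := Γ.degree x * Γ.degree y - (ν - 1) ^ 2) (b := Γ.degree x + Γ.degree y + 2 * ν - 2) ?_ ?_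
    · have h3 : 0 < (Γ.degree x + Γ.degree y + 2 * ν - 2 : ℝ) := by
        rw [h1, hdx, hdy]
        nlinarith [sq_nonneg (α x + α y), mul_pos (hpos x) (hpos y), pow_pos (hpos x) 2]
      have h4 : (0 : ℤ) < Γ.degree x + Γ.degree y + 2 * ν - 2 := by exact_mod_cast h3
      exact h4.ne'
    · push_cast
      rw [h1, hdx, hdy]
      ring
  refine ⟨T, hT, fun x hx => ?_⟩
  subst hT
  have hx1 : α x = 1 := by
    have h1 := hdeg x
    have h2 := pow_pos (hpos x) 2
    have h3 : (T : ℤ) < Γ.degree x := by exact_mod_cast (by linarith : (T : ℝ) < Γ.degree x)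
    have h4 : (Γ.degree x : ℤ) < T + 2 := by exact_mod_cast hx
    have h5 : (Γ.degree x : ℤ) = T + 1 := by omega
    have h6 : (Γ.degree x : ℝ) = T + 1 := by exact_mod_cast h5
    rw [h6] at h1
    nlinarith [hpos x]
  have hintegral : ∀ v, ∃ b : ℤ, α v = b := by
    intro v
    rcases eq_or_ne x v with rfl | hne
    · exact ⟨1, by simpa using hx1⟩
    by_cases hxv : Γ.Adj x v
    · refine ⟨#(Γ.neighborFinset x ∩ Γ.neighborFinset v) + (T - 1), ?_⟩
      push_cast
      rw [hadj x v hxv, hx1]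
      ring
    · refine ⟨#(Γ.neighborFinset x ∩ Γ.neighborFinset v), ?_⟩
      push_cast
      rw [hnot x v hne hxv, hx1, one_mul]
  choose β hβ using hintegral
  obtain rfl : α = fun v => (β v : ℝ) := funext hβ
  beta_reduce at hpos hdeg hadj hnot hx1
  have hsum : ∀ v, (∑ w ∈ Γ.neighborFinset v, (β w : ℝ)) = s * β v := by
    intro v
    have := congrFun heig v
    rwa [adjMatrix_mulVec_apply] at this
  have hβx : β x = 1 := by exact_mod_cast hx1
  have hS : s = (∑ w ∈ Γ.neighborFinset x, β w : ℤ) := by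
    have := hsum x
    rw [hx1, mul_one] at this
    rw [← this]
    push_cast
    rfl
  refine ⟨∑ w ∈ Γ.neighborFinset x, β w, β, hβx, ?_, ?_, ?_, ?_, ?_, ?_⟩
  · intro v
    have := hpos v
    exact_mod_cast this
  · intro v
    have := hdeg v
    rw [card_neighborFinset_eq_degree]
    exact_mod_cast this
  · intro u v huv
    exact_mod_cast hadj u v huv
  · intro u v huv h
    exact_mod_cast hnot u v huv h
  · intro v
    have := hsum v
    rw [hS] at this
    exact_mod_cast this
  · intro x y v
    exact card_sdiff_neighborFinset_le_one ht hpos hM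

end SimpleGraph

/-- A graph in H′(s,t) with t ≥ 7 has minimum degree δ(Γ) ≥ t + 2. -/
theorem H'_st_min_degree_ge_t_add_two
    {V : Type} [Fintype V] [DecidableEq V] (Γ : SimpleGraph V) [DecidableRel Γ.Adj]
    (s t : ℝ)
    (hconn : Γ.Connected)
    (hnonreg : ¬ ∃ k, Γ.IsRegularOfDegree k)
    (hs : 1 < s) (ht : -t < 1)
    (hspec : spectrum ℝ (Γ.adjMatrix ℝ) = {s, 1, -t})
    (hnotcone : ¬ ∃ v : V, Γ.degree v = Fintype.card V - 1)
    (hnotbireg : ((Finset.univ : Finset V).image (fun v => Γ.degree v)).card ≠ 2)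
    (ht7 : 7 ≤ t) :
    (Γ.minDegree : ℝ) ≥ t + 2 := by
  by_contra! hlt
  obtain ⟨T, rfl, hT⟩ := SimpleGraph.exists_isTripleWeighting hconn hs (by linarith) hspec
  have := hconn.nonempty
  obtain ⟨x, hx⟩ := Γ.exists_minimal_degree_vertex
  rw [hx] at hlt
  obtain ⟨S, β, hβ, h⟩ := hT x hlt
  refine h.weight_ne_one (by exact_mod_cast ht7) (fun v => ?_) x hβ
  by_contra! hv
  refine hnotcone ⟨v, ?_⟩
  rw [← Γ.card_neighborFinset_eq_degree, ← Finset.card_univ,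
    ← Finset.card_erase_of_mem (Finset.mem_univ v)]
  congr 1
  ext w
  simp only [SimpleGraph.mem_neighborFinset, Finset.mem_erase, Finset.mem_univ, and_true]
  exact ⟨fun h => h.ne', fun h => hv w h.symm⟩
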